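/- Let X be an O-regular compact set in C^n, i.e., the set O_X is closed. Then for every real-valued continuous function phi on B_X there is a real-valued continuous plurisubharmonic function u on X (u in PSH^c(X)) which is equal to phi on B_X. -/

import Mathlib

open MeasureTheory Metric Filter Topology Set Complex
open scoped ENNReal

noncomputable section

/-- `ℂⁿ`. -/
abbrev En (n : ℕ) : Type := EuclideanSpace ℂ (Fin n)

instance (n : ℕ) : MeasurableSpace (En n) := borel _

instance (n : ℕ) : BorelSpace (En n) := ⟨rfl⟩

open Classical in
/-- The positive part of an extended real number, as an element of `ℝ≥0∞`. -/
def epos (x : EReal) : ℝ≥0∞ := if x = ⊤ then ⊤ else ENNReal.ofReal x.toReal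

/-- The integral of an `EReal`-valued function `u` against a measure `μ`, defined as the
difference of the lower integrals of the positive and negative parts of `u`. -/
def eint {α : Type*} [MeasurableSpace α] (μ : Measure α) (u : α → EReal) : EReal :=
  ((∫⁻ x, epos (u x) ∂μ : ℝ≥0∞) : EReal) - ((∫⁻ x, epos (-(u x)) ∂μ : ℝ≥0∞) : EReal)

/-- The normalized angular measure `(2π)⁻¹ dθ` on `[0, 2π)`. -/
def thetaM : Measure ℝ :=
  (ENNReal.ofReal ((2 * Real.pi)⁻¹)) • (volume.restrict (Set.Ico (0 : ℝ) (2 * Real.pi)))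

/-- A function `u` with values in `[-∞, ∞)` is plurisubharmonic on an open set `U ⊆ ℂⁿ`:
it is upper semicontinuous, `< ⊤`, and satisfies the sub-mean-value inequality on every
complex line. -/
def PshOnE {n : ℕ} (u : En n → EReal) (U : Set (En n)) : Prop :=
  UpperSemicontinuousOn u U ∧ (∀ z ∈ U, u z < ⊤) ∧
  ∀ z ∈ U, ∀ w : En n, ∀ r : ℝ, 0 < r →
    (∀ ζ : ℂ, ‖ζ‖ ≤ r → z + ζ • w ∈ U) →
    u z ≤ eint thetaM (fun θ => u (z + (circleMap 0 r θ) • w))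

/-- `μ` is a Jensen measure on `X` with barycenter `z`:  a Borel probability measure
supported on `X` such that `u z ≤ ∫ u dμ` for every function `u` continuous and
plurisubharmonic on some open neighborhood of `X`. -/
def IsJensen {n : ℕ} (X : Set (En n)) (z : En n) (μ : Measure (En n)) : Prop :=
  IsProbabilityMeasure μ ∧ μ Xᶜ = 0 ∧
  ∀ U : Set (En n), IsOpen U → X ⊆ U →
    ∀ u : En n → EReal, ContinuousOn u U → PshOnE u U → u z ≤ eint μ u

/-- `u : X → [-∞, ∞)` is plurisubharmonic on the compact set `X` : it is upper
semicontinuous on `X`, `< ⊤` on `X`, and satisfies the subaveraging inequality with respect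
to all Jensen measures on `X`. -/
def PSHe {n : ℕ} (X : Set (En n)) (u : En n → EReal) : Prop :=
  UpperSemicontinuousOn u X ∧ (∀ z ∈ X, u z < ⊤) ∧
  ∀ z ∈ X, ∀ μ : Measure (En n), IsJensen X z μ → u z ≤ eint μ u

/-- `PSH^c(X)`: continuous plurisubharmonic functions on `X`. -/
def PSHce {n : ℕ} (X : Set (En n)) (u : En n → EReal) : Prop :=
  PSHe X u ∧ ContinuousOn u X

/-- Real-valued continuous plurisubharmonic functions on `X`. -/
def PSHcR {n : ℕ} (X : Set (En n)) (u : En n → ℝ) : Prop :=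
  ContinuousOn u X ∧ PSHe X (fun x => (u x : EReal))

/-- `O_X`: the set of points `z ∈ X` whose only Jensen measure is `δ_z`. -/
def Oset {n : ℕ} (X : Set (En n)) : Set (En n) :=
  {z | z ∈ X ∧ ∀ μ : Measure (En n), IsJensen X z μ → μ = Measure.dirac z}

/-- The potential boundary `B_X`, the closure of `O_X`. -/
def Bset {n : ℕ} (X : Set (En n)) : Set (En n) := closure (Oset X)

/-- `J^b_z(X)`: Jensen measures with barycenter `z` supported on `B_X`. -/
def IsJensenB {n : ℕ} (X : Set (En n)) (z : En n) (μ : Measure (En n)) : Prop :=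
  IsJensen X z μ ∧ μ (Bset X)ᶜ = 0

/-- `ν` is subordinated to `μ` : `μ(u) ≥ ν(u)` for all `u ∈ PSH^c(X)`. -/
def Subord {n : ℕ} (X : Set (En n)) (μ ν : Measure (En n)) : Prop :=
  ∀ u : En n → EReal, PSHce X u → eint ν u ≤ eint μ u

/-- Subharmonic functions with values in `[-∞, ∞)` on an open set `U ⊆ ℂ`. -/
def SubharmOn (u : ℂ → EReal) (U : Set ℂ) : Prop :=
  UpperSemicontinuousOn u U ∧ (∀ z ∈ U, u z < ⊤) ∧
  ∀ z ∈ U, ∀ r : ℝ, 0 < r → closedBall z r ⊆ U →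
    u z ≤ eint thetaM (fun θ => u (circleMap z r θ))

/-- Harmonic (real-valued) functions on an open set `U ⊆ ℂ`: continuous functions
satisfying the mean-value equality. -/
def HarmOn (h : ℂ → ℝ) (U : Set ℂ) : Prop :=
  ContinuousOn h U ∧
  ∀ z ∈ U, ∀ r : ℝ, 0 < r → closedBall z r ⊆ U →
    h z = (2 * Real.pi)⁻¹ * ∫ θ in (0 : ℝ)..(2 * Real.pi), h (circleMap z r θ)

/-- Superharmonic (real-valued) functions on an open set `U ⊆ ℂ`. -/
def SuperharmOn (v : ℂ → ℝ) (U : Set ℂ) : Prop :=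
  LowerSemicontinuousOn v U ∧
  ∀ z ∈ U, ∀ r : ℝ, 0 < r → closedBall z r ⊆ U →
    (2 * Real.pi)⁻¹ * (∫ θ in (0 : ℝ)..(2 * Real.pi), v (circleMap z r θ)) ≤ v z

/-- The infimum of all positive superharmonic functions on the unit disk, extending
continuously to the closed disk and `≥ 1` on `A`, evaluated at `z`. -/
def hmPre (A : Set ℂ) (z : ℂ) : ℝ :=
  sInf {t : ℝ | ∃ v : ℂ → ℝ, SuperharmOn v (ball 0 1) ∧ (∀ w ∈ ball (0 : ℂ) 1, 0 < v w) ∧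
    ContinuousOn v (closedBall 0 1) ∧ (∀ w ∈ A, 1 ≤ v w) ∧ t = v z}

/-- The harmonic measure `ω(z, A, 𝔻)` of `A` with respect to the unit disk. -/
def hm (z : ℂ) (A : Set ℂ) : ℝ := Filter.liminf (fun w => hmPre A w) (𝓝 z)

open Classical in
/-- The radial limit of a map `f` at the boundary point `ζ` of the unit circle
(junk value `0` if the radial limit does not exist). -/
def bval {n : ℕ} (f : ℂ → En n) (ζ : ℂ) : En n :=
  if h : ∃ l : En n, Tendsto (fun r : ℝ => f ((r : ℂ) * ζ)) (𝓝[<] (1 : ℝ)) (𝓝 l)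
  then h.choose else 0

open Classical in
/-- The radial limit of an `EReal`-valued function on the disk at the boundary point `ζ`. -/
def bvalE (g : ℂ → EReal) (ζ : ℂ) : EReal :=
  if h : ∃ l : EReal, Tendsto (fun r : ℝ => g ((r : ℂ) * ζ)) (𝓝[<] (1 : ℝ)) (𝓝 l)
  then h.choose else 0

/-- `μ_f`: the push-forward of the normalized arclength measure on the unit circle under the
radial boundary values of `f`. -/
def bmeas {n : ℕ} (f : ℂ → En n) : Measure (En n) :=
  thetaM.map (fun θ => bval f (circleMap 0 1 θ))

/-- Weak-* convergence of a sequence of measures on `ℂⁿ`. -/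
def WeakConv {n : ℕ} (μs : ℕ → Measure (En n)) (μ : Measure (En n)) : Prop :=
  ∀ φ : BoundedContinuousFunction (En n) ℝ,
    Tendsto (fun j => ∫ x, φ x ∂(μs j)) atTop (𝓝 (∫ x, φ x ∂μ))

/-- The cluster set `cl L` of a sequence of maps of the unit disk into `ℂⁿ`. -/
def clusterSet {n : ℕ} (f : ℕ → ℂ → En n) : Set (En n) :=
  {z | ∀ r : ℝ, 0 < r → ∀ N : ℕ, ∃ j, N ≤ j ∧ ∃ ζ ∈ ball (0 : ℂ) 1, f j ζ ∈ ball z r}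

/-- A point `z` is totally essential for the sequence `f` if for every open set `V ∋ z` the
harmonic measures at `0` of `f j ⁻¹' V` stay bounded away from `0`. -/
def TotallyEssential {n : ℕ} (f : ℕ → ℂ → En n) (z : En n) : Prop :=
  ∀ V : Set (En n), IsOpen V → z ∈ V →
    0 < Filter.atTop.liminf (fun j => hm 0 ((f j ⁻¹' V) ∩ ball 0 1))

/-- A totally perfect sequence `L` of holomorphic maps of the unit disk into `ℂⁿ`: a
uniformly bounded sequence of holomorphic maps which is weak-* converging (with limit measure
`μ_L` and center `z_L`) and all of whose cluster points are totally essential. -/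
structure PerfectSeq (n : ℕ) where
  f : ℕ → ℂ → En n
  holo : ∀ j, DifferentiableOn ℂ (f j) (ball 0 1)
  bdd : ∃ C : ℝ, ∀ j, ∀ ζ ∈ ball (0 : ℂ) 1, ‖f j ζ‖ ≤ C
  μL : Measure (En n)
  conv : WeakConv (fun j => bmeas (f j)) μL
  zL : En n
  center : Tendsto (fun j => f j 0) atTop (𝓝 zL)
  ess : ∀ z ∈ clusterSet f, TotallyEssential f z

/-- `J_z^s(L)`: the measures obtained as weak-* limits of `μ_{f_{j_k} ∘ g_k}` for subsequences
`{j_k}` and holomorphic maps `g_k : 𝔻 → 𝔻` with `f_{j_k}(g_k(0)) → z`. -/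
def JsSet {n : ℕ} (L : PerfectSeq n) (z : En n) : Set (Measure (En n)) :=
  {μ | ∃ jk : ℕ → ℕ, StrictMono jk ∧ ∃ g : ℕ → ℂ → ℂ,
    (∀ k, DifferentiableOn ℂ (g k) (ball 0 1) ∧ MapsTo (g k) (ball 0 1) (ball 0 1)) ∧
    WeakConv (fun k => bmeas ((L.f (jk k)) ∘ (g k))) μ ∧
    Tendsto (fun k => L.f (jk k) (g k 0)) atTop (𝓝 z)}

/-- `J_z(L)`: the convex hull of `J_z^s(L)`. -/
def JLSet {n : ℕ} (L : PerfectSeq n) (z : En n) : Set (Measure (En n)) :=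
  {μ | ∃ (m : ℕ) (w : Fin m → ℝ) (ν : Fin m → Measure (En n)),
    (∀ i, 0 ≤ w i) ∧ (∑ i, w i = 1) ∧ (∀ i, ν i ∈ JsSet L z) ∧
    μ = ∑ i, (ENNReal.ofReal (w i)) • ν i}

/-- `u` is harmonic on the totally perfect sequence `L`. -/
def HarmonicOnL {n : ℕ} (L : PerfectSeq n) (u : En n → EReal) : Prop :=
  PSHce (clusterSet L.f) u ∧
  ∀ z ∈ clusterSet L.f, ∀ μ ∈ JLSet L z, eint μ u = u z

/-- `PSH^w(X)`: weakly plurisubharmonic functions, the upper envelopes of nonempty families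
of continuous plurisubharmonic functions on `X`. -/
def PSHw {n : ℕ} (X : Set (En n)) (u : En n → EReal) : Prop :=
  ∃ F : Set (En n → EReal), F.Nonempty ∧ (∀ v ∈ F, PSHce X v) ∧
    ∀ x ∈ X, u x = ⨆ v ∈ F, v x

/-- `u` is maximal on `X ∖ Z`: for every relatively open `V ⊆ X ∖ Z` and every
`v ∈ PSH^c(closure V)`, if `v ≤ u` on the relative boundary of `V` in `X` then `v ≤ u`
on `closure V`. -/
def MaximalOn {n : ℕ} (X Z : Set (En n)) (u : En n → EReal) : Prop :=
  ∀ W : Set (En n), IsOpen W → X ∩ W ⊆ X \ Z →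
    ∀ v : En n → EReal, PSHce (closure (X ∩ W)) v →
      (∀ x ∈ closure (X ∩ W) \ (X ∩ W), v x ≤ u x) →
      ∀ x ∈ closure (X ∩ W), v x ≤ u x

/-- Pluriharmonic continuous real-valued functions on `X`. -/
def Pluriharm {n : ℕ} (X : Set (En n)) (h : En n → ℝ) : Prop :=
  ContinuousOn h X ∧
  ∀ z ∈ X, ∀ μ : Measure (En n), IsJensen X z μ → (h z : EReal) = eint μ (fun x => (h x : EReal))

/-- `X` is a Poisson set: every continuous real-valued function on `B_X` extends to a
pluriharmonic function on `X`. -/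
def PoissonSet {n : ℕ} (X : Set (En n)) : Prop :=
  ∀ φ : En n → ℝ, ContinuousOn φ (Bset X) →
    ∃ h : En n → ℝ, Pluriharm X h ∧ ∀ w ∈ Bset X, h w = φ w

end
theorem epos_mono {x y : EReal} (h : x ≤ y) : epos x ≤ epos y := by
  unfold epos
  split_ifs with hx hy hy
  · exact le_rfl
  · exact absurd (top_le_iff.1 (hx ▸ h)) hy
  · exact le_top
  · induction x with
    | bot => simp
    | top => exact absurd rfl hx
    | coe a =>
      induction y with
      | bot => simp at h
      | top => exact absurd rfl hy
      | coe b => exact ENNReal.ofReal_le_ofReal (by simpa using h)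

theorem epos_coe (a : ℝ) : epos (a : EReal) = ENNReal.ofReal a := by
  simp [epos]

theorem epos_max_neg_natCast (x : EReal) (N : ℕ) :
    epos (max x ((-(N : ℝ) : ℝ) : EReal)) = epos x := by
  induction x with
  | bot => rw [max_eq_right bot_le, epos_coe, ENNReal.ofReal_of_nonpos (by simp)]; simp [epos]
  | top => simp
  | coe a =>
    rw [← EReal.coe_strictMono.monotone.map_max, epos_coe, epos_coe]
    rcases le_total a (-(N : ℝ)) with h | h
    · rw [max_eq_right h, ENNReal.ofReal_of_nonpos (by simp), ENNReal.ofReal_of_nonpos]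
      exact h.trans (by simp)
    · rw [max_eq_left h]

theorem epos_neg_max_neg_natCast (x : EReal) (N : ℕ) :
    epos (-(max x ((-(N : ℝ) : ℝ) : EReal))) = min (epos (-x)) N := by
  induction x with
  | bot =>
    rw [max_eq_right bot_le, ← EReal.coe_neg, epos_coe, neg_neg, ENNReal.ofReal_natCast]
    simp [epos]
  | top => simp [epos]
  | coe a =>
    rw [← EReal.coe_strictMono.monotone.map_max, ← EReal.coe_neg, ← EReal.coe_neg, epos_coe,
      epos_coe, max_def]
    split_ifs with h
    · rw [neg_neg, ENNReal.ofReal_natCast, min_eq_right]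
      rw [← ENNReal.ofReal_natCast]
      exact ENNReal.ofReal_le_ofReal (by linarith)
    · rw [min_eq_left]
      rw [← ENNReal.ofReal_natCast]
      exact ENNReal.ofReal_le_ofReal (by linarith)

theorem continuous_epos : Continuous epos := by
  have h : epos = EReal.toENNReal := by
    funext x
    simp [epos, EReal.toENNReal]
  rw [h]
  exact EReal.continuous_toENNReal

section Eint

variable {α : Type*} [MeasurableSpace α] {μ : Measure α}

theorem eint_mono_ae {u v : α → EReal} (h : ∀ᵐ x ∂μ, u x ≤ v x) : eint μ u ≤ eint μ v :=
  EReal.sub_le_sub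
    (EReal.coe_ennreal_le_coe_ennreal_iff.2 (lintegral_mono_ae (h.mono fun _ hx => epos_mono hx)))
    (EReal.coe_ennreal_le_coe_ennreal_iff.2
      (lintegral_mono_ae (h.mono fun _ hx => epos_mono (EReal.neg_le_neg_iff.2 hx))))

theorem eint_congr_ae {u v : α → EReal} (h : ∀ᵐ x ∂μ, u x = v x) : eint μ u = eint μ v :=
  le_antisymm (eint_mono_ae (h.mono fun _ hx => hx.le)) (eint_mono_ae (h.mono fun _ hx => hx.ge))

theorem eint_coe {f : α → ℝ} (hf : Integrable f μ) :
    eint μ (fun x => (f x : EReal)) = ((∫ x, f x ∂μ : ℝ) : EReal) := by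
  have h1 : ∫⁻ x, ENNReal.ofReal (f x) ∂μ ≠ ⊤ := hf.lintegral_lt_top.ne
  have h2 : ∫⁻ x, ENNReal.ofReal (-f x) ∂μ ≠ ⊤ := hf.neg.lintegral_lt_top.ne
  rw [integral_eq_lintegral_pos_part_sub_lintegral_neg_part hf, EReal.coe_sub,
    EReal.coe_ennreal_toReal h1, EReal.coe_ennreal_toReal h2]
  simp only [eint, ← EReal.coe_neg, epos_coe]

/-- A bound on the integrals of all truncations from below passes to the integral. -/
theorem le_eint_of_forall_le_eint_max {u : α → EReal} (hu : AEMeasurable u μ)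
    (hfin : ∫⁻ x, epos (u x) ∂μ ≠ ⊤) {c : EReal}
    (h : ∀ N : ℕ, c ≤ eint μ (fun x => max (u x) ((-(N : ℝ) : ℝ) : EReal))) :
    c ≤ eint μ u := by
  simp only [eint, epos_max_neg_natCast, epos_neg_max_neg_natCast] at h
  have hm : AEMeasurable (fun x => epos (-(u x))) μ :=
    (continuous_epos.comp continuous_neg).measurable.comp_aemeasurable hu
  have hlim : Tendsto (fun N : ℕ => ∫⁻ x, min (epos (-(u x))) N ∂μ) atTop
      (𝓝 (∫⁻ x, epos (-(u x)) ∂μ)) := by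
    refine lintegral_tendsto_of_tendsto_of_monotone (fun N => hm.min aemeasurable_const)
      (ae_of_all _ fun x N M hNM => min_le_min le_rfl (by exact_mod_cast hNM))
      (ae_of_all _ fun x => ?_)
    simpa using (tendsto_const_nhds (x := epos (-(u x)))).min ENNReal.tendsto_nat_nhds_top
  have hlim' := (continuous_coe_ennreal_ereal.tendsto _).comp hlim
  have hneg := (continuous_neg.tendsto _).comp hlim'
  have hA : ((∫⁻ x, epos (u x) ∂μ : ℝ≥0∞) : EReal) ≠ ⊤ := by simpa using hfin
  have hA' : ((∫⁻ x, epos (u x) ∂μ : ℝ≥0∞) : EReal) ≠ ⊥ := by simp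
  have hsub := (EReal.continuousAt_add (p := (_, _)) (Or.inl hA) (Or.inl hA')).tendsto.comp
    ((tendsto_const_nhds (f := (atTop : Filter ℕ))).prodMk_nhds hneg)
  exact ge_of_tendsto' hsub h

end Eint

instance : IsProbabilityMeasure thetaM := by
  refine ⟨?_⟩
  rw [thetaM, Measure.smul_apply, Measure.restrict_apply_univ, Real.volume_Ico, sub_zero,
    smul_eq_mul, ← ENNReal.ofReal_mul (by positivity), inv_mul_cancel₀ (by positivity),
    ENNReal.ofReal_one]

section

variable {n : ℕ}

theorem ContinuousOn.integrable_of_compl_null {X : Set (En n)} (hX : IsCompact X)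
    {μ : Measure (En n)} [IsFiniteMeasure μ] (hμ : μ Xᶜ = 0) {f : En n → ℝ}
    (hf : ContinuousOn f X) : Integrable f μ := by
  have h := hf.integrableOn_compact (μ := μ) hX
  rwa [IntegrableOn, Measure.restrict_eq_self_of_ae_mem] at h
  rwa [ae_iff]

theorem add_circleMap_smul_mem {z w : En n} {r : ℝ} (hr : 0 < r) {U : Set (En n)}
    (h : ∀ ζ : ℂ, ‖ζ‖ ≤ r → z + ζ • w ∈ U) (θ : ℝ) : z + circleMap 0 r θ • w ∈ U :=
  h _ (by simp [abs_of_pos hr])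

theorem integrable_circle {v : En n → ℝ} {U : Set (En n)} (hv : ContinuousOn v U) {z w : En n}
    {r : ℝ} (hr : 0 < r) (h : ∀ ζ : ℂ, ‖ζ‖ ≤ r → z + ζ • w ∈ U) :
    Integrable (fun θ => v (z + circleMap 0 r θ • w)) thetaM := by
  have hc : Continuous (fun θ => v (z + circleMap 0 r θ • w)) :=
    hv.comp_continuous (by fun_prop) (add_circleMap_smul_mem hr h)
  have h1 := (hc.continuousOn.integrableOn_compact (μ := volume)
    (isCompact_Icc (a := (0 : ℝ)) (b := 2 * Real.pi))).mono_set Ico_subset_Icc_self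
  exact h1.smul_measure ENNReal.ofReal_ne_top

theorem pshOnE_coe_iff {v : En n → ℝ} {U : Set (En n)} (hv : ContinuousOn v U) :
    PshOnE (fun x => (v x : EReal)) U ↔ ∀ z ∈ U, ∀ w : En n, ∀ r : ℝ, 0 < r →
      (∀ ζ : ℂ, ‖ζ‖ ≤ r → z + ζ • w ∈ U) →
      v z ≤ ∫ θ, v (z + circleMap 0 r θ • w) ∂thetaM := by
  have hc : ContinuousOn (fun x => (v x : EReal)) U :=
    continuous_coe_real_ereal.comp_continuousOn hv
  refine ⟨fun h z hz w r hr hζ => ?_, fun h =>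
    ⟨hc.upperSemicontinuousOn, fun z _ => EReal.coe_lt_top _, fun z hz w r hr hζ => ?_⟩⟩
  · have := h.2.2 z hz w r hr hζ
    rwa [eint_coe (integrable_circle hv hr hζ), EReal.coe_le_coe_iff] at this
  · rw [eint_coe (integrable_circle hv hr hζ), EReal.coe_le_coe_iff]
    exact h z hz w r hr hζ

/-- Real-valued functions that are continuous and plurisubharmonic on an open neighborhood
of `X`. -/
def PshNear (X : Set (En n)) (v : En n → ℝ) : Prop :=
  ∃ U : Set (En n), IsOpen U ∧ X ⊆ U ∧ ContinuousOn v U ∧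
    ∀ z ∈ U, ∀ w : En n, ∀ r : ℝ, 0 < r → (∀ ζ : ℂ, ‖ζ‖ ≤ r → z + ζ • w ∈ U) →
      v z ≤ ∫ θ, v (z + circleMap 0 r θ • w) ∂thetaM

namespace PshNear

variable {X : Set (En n)} {u v : En n → ℝ}

theorem continuousOn (hv : PshNear X v) : ContinuousOn v X := by
  obtain ⟨U, -, hXU, hc, -⟩ := hv
  exact hc.mono hXU

theorem const (X : Set (En n)) (c : ℝ) : PshNear X fun _ => c :=
  ⟨univ, isOpen_univ, subset_univ _, continuousOn_const, fun z _ w r _ _ => by simp⟩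

theorem const_mul (hv : PshNear X v) {c : ℝ} (hc : 0 ≤ c) : PshNear X fun x => c * v x := by
  obtain ⟨U, hU, hXU, hcont, h⟩ := hv
  refine ⟨U, hU, hXU, continuousOn_const.mul hcont, fun z hz w r hr hζ => ?_⟩
  rw [integral_const_mul]
  exact mul_le_mul_of_nonneg_left (h z hz w r hr hζ) hc

theorem add (hu : PshNear X u) (hv : PshNear X v) : PshNear X fun x => u x + v x := by
  obtain ⟨U, hU, hXU, hcU, h⟩ := hu
  obtain ⟨V, hV, hXV, hcV, h'⟩ := hv
  refine ⟨U ∩ V, hU.inter hV, subset_inter hXU hXV,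
    (hcU.mono inter_subset_left).add (hcV.mono inter_subset_right), fun z hz w r hr hζ => ?_⟩
  have h1 := fun ζ hn => (hζ ζ hn).1
  have h2 := fun ζ hn => (hζ ζ hn).2
  rw [integral_add (integrable_circle hcU hr h1) (integrable_circle hcV hr h2)]
  exact add_le_add (h z hz.1 w r hr h1) (h' z hz.2 w r hr h2)

theorem max (hu : PshNear X u) (hv : PshNear X v) : PshNear X fun x => max (u x) (v x) := by
  obtain ⟨U, hU, hXU, hcU, h⟩ := hu
  obtain ⟨V, hV, hXV, hcV, h'⟩ := hv
  refine ⟨U ∩ V, hU.inter hV, subset_inter hXU hXV,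
    (hcU.mono inter_subset_left).sup (hcV.mono inter_subset_right), fun z hz w r hr hζ => ?_⟩
  have h1 := fun ζ hn => (hζ ζ hn).1
  have h2 := fun ζ hn => (hζ ζ hn).2
  have hi1 := integrable_circle hcU hr h1
  have hi2 := integrable_circle hcV hr h2
  exact max_le
    ((h z hz.1 w r hr h1).trans (integral_mono hi1 (hi1.sup hi2) fun θ => le_max_left _ _))
    ((h' z hz.2 w r hr h2).trans (integral_mono hi2 (hi1.sup hi2) fun θ => le_max_right _ _))

/-- The subaveraging inequality with respect to a Jensen measure. -/
theorem le_integral (hX : IsCompact X) (hv : PshNear X v) {z : En n} {μ : Measure (En n)}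
    (hμ : IsJensen X z μ) : v z ≤ ∫ x, v x ∂μ := by
  have := hμ.1
  have hi := hv.continuousOn.integrable_of_compl_null hX hμ.2.1
  obtain ⟨U, hU, hXU, hc, h⟩ := hv
  have := hμ.2.2 U hU hXU (fun x => (v x : EReal)) (continuous_coe_real_ereal.comp_continuousOn hc)
    ((pshOnE_coe_iff hc).2 h)
  rwa [eint_coe hi, EReal.coe_le_coe_iff] at this

end PshNear

theorem eint_const {α : Type*} [MeasurableSpace α] (μ : Measure α) [IsProbabilityMeasure μ]
    (c : ℝ) : eint μ (fun _ => (c : EReal)) = c := by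
  simp [eint_coe (integrable_const c)]

/-- It suffices to test real-valued functions in the definition of a Jensen measure. -/
theorem isJensen_of_forall_pshNear {X : Set (En n)} (hX : IsCompact X) {z : En n} (hz : z ∈ X)
    {μ : Measure (En n)} [IsProbabilityMeasure μ] (hμ : μ Xᶜ = 0)
    (h : ∀ v, PshNear X v → v z ≤ ∫ x, v x ∂μ) : IsJensen X z μ := by
  refine ⟨inferInstance, hμ, fun U hU hXU u hu hpsh => ?_⟩
  have hae : ∀ᵐ x ∂μ, x ∈ X := by rwa [ae_iff]
  have hmeas : AEMeasurable u μ := by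
    have := (hu.mono hXU).aemeasurable (μ := μ) hX.measurableSet
    rwa [Measure.restrict_eq_self_of_ae_mem hae] at this
  have hfin : ∫⁻ x, epos (u x) ∂μ ≠ ⊤ := by
    obtain ⟨y, hy, hmax⟩ := hX.exists_isMaxOn ⟨z, hz⟩ (hu.mono hXU)
    have hlt : epos (u y) ≠ ⊤ := by simp [epos, (hpsh.2.1 y (hXU hy)).ne]
    refine ((lintegral_mono_ae (hae.mono fun x hx => epos_mono (hmax hx))).trans_lt ?_).ne
    simpa using hlt.lt_top
  refine le_eint_of_forall_le_eint_max hmeas hfin fun N => ?_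
  set t : En n → EReal := fun x => max (u x) ((-(N : ℝ) : ℝ) : EReal) with ht
  have htop : ∀ x ∈ U, t x ≠ ⊤ := fun x hx =>
    (max_lt (hpsh.2.1 x hx) (EReal.coe_lt_top _)).ne
  have hbot : ∀ x, t x ≠ ⊥ := fun x =>
    ((EReal.bot_lt_coe _).trans_le (le_max_right _ _)).ne'
  have htc : ContinuousOn t U := hu.sup continuousOn_const
  have hcoe : ∀ x ∈ U, ((t x).toReal : EReal) = t x := fun x hx =>
    EReal.coe_toReal (htop x hx) (hbot x)
  have hvc : ContinuousOn (fun x => (t x).toReal) U := fun x hx =>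
    (EReal.tendsto_toReal (htop x hx) (hbot x)).comp (htc x hx)
  have hv : PshNear X fun x => (t x).toReal := by
    refine ⟨U, hU, hXU, hvc, fun x hx w r hr hζ => ?_⟩
    rw [← EReal.coe_le_coe_iff, ← eint_coe (integrable_circle hvc hr hζ), hcoe x hx]
    simp only [hcoe _ (add_circleMap_smul_mem hr hζ _)]
    refine max_le ((hpsh.2.2 x hx w r hr hζ).trans
      (eint_mono_ae (ae_of_all _ fun θ => le_max_left _ _))) ?_
    exact (eint_const thetaM _).ge.trans (eint_mono_ae (ae_of_all _ fun θ => le_max_right _ _))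
  have hle := h _ hv
  rw [← EReal.coe_le_coe_iff, hcoe z (hXU hz),
    ← eint_coe (hv.continuousOn.integrable_of_compl_null hX hμ)] at hle
  exact (le_max_left _ _).trans
    (hle.trans_eq (eint_congr_ae (hae.mono fun x hx => hcoe x (hXU hx))))

end

section

variable {n : ℕ}

/-- A positive linear functional on `C(X, ℝ)` dominating evaluation at `z` on plurisubharmonic
functions, normalized by its value at `1`, is represented by a Jensen measure. -/
theorem exists_isJensen_of_functional {X : Set (En n)} (hX : IsCompact X) {z : En n} (hz : z ∈ X)
    (f : C(X, ℝ) →ₗ[ℝ] ℝ) (hpos : ∀ h : C(X, ℝ), 0 ≤ h → 0 ≤ f h) (hone : 0 < f 1)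
    (hf : ∀ v (hv : PshNear X v), f 1 * v z ≤ f ⟨X.domRestrict v, hv.continuousOn.domRestrict⟩) :
    ∃ μ : Measure (En n), IsJensen X z μ ∧
      ∀ g (hg : ContinuousOn g X), f 1 * ∫ x, g x ∂μ = f ⟨X.domRestrict g, hg.domRestrict⟩ := by
  have : CompactSpace X := isCompact_iff_compactSpace.1 hX
  let toC : CompactlySupportedContinuousMap X ℝ →ₗ[ℝ] C(X, ℝ) :=
    { toFun := fun h => h.toContinuousMap
      map_add' := fun _ _ => rfl
      map_smul' := fun _ _ => rfl }
  let Λ : CompactlySupportedContinuousMap X ℝ →ₚ[ℝ] ℝ :=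
    PositiveLinearMap.mk₀ ((f 1)⁻¹ • f.comp toC) fun h hh =>
      mul_nonneg (inv_nonneg.2 hone.le) (hpos _ fun x => hh x)
  set ν := RealRMK.rieszMeasure Λ with hν
  have hint : ∀ h : C(X, ℝ), ∫ x, h x ∂ν = (f 1)⁻¹ * f h := fun h =>
    RealRMK.integral_rieszMeasure Λ (CompactlySupportedContinuousMap.continuousMapEquiv h)
  have hfin : IsFiniteMeasure ν := ⟨by
    rw [hν]
    exact isCompact_univ.measure_lt_top⟩
  have hprob : IsProbabilityMeasure ν := ⟨by
    have h1 := hint 1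
    rw [inv_mul_cancel₀ hone.ne'] at h1
    have h2 : ν.real univ = 1 := by simpa using h1
    rwa [Measure.real, ENNReal.toReal_eq_one_iff] at h2⟩
  have hemb : MeasurableEmbedding ((↑) : X → En n) := .subtype_coe hX.measurableSet
  have hmap : ∀ g (hg : ContinuousOn g X),
      ∫ x, g x ∂(ν.map (↑)) = (f 1)⁻¹ * f ⟨X.domRestrict g, hg.domRestrict⟩ := fun g hg => by
    rw [hemb.integral_map]
    exact hint ⟨X.domRestrict g, hg.domRestrict⟩
  have hprob' : IsProbabilityMeasure (ν.map ((↑) : X → En n)) :=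
    Measure.isProbabilityMeasure_map hemb.measurable.aemeasurable
  refine ⟨ν.map (↑), isJensen_of_forall_pshNear hX hz ?_ fun v hv => ?_, fun g hg => ?_⟩
  · rw [hemb.map_apply]
    simp
  · rw [hmap v hv.continuousOn]
    calc v z = (f 1)⁻¹ * (f 1 * v z) := by field_simp
      _ ≤ _ := mul_le_mul_of_nonneg_left (hf v hv) (inv_nonneg.2 hone.le)
  · rw [hmap g hg, mul_inv_cancel_left₀ hone.ne']

/-- Pointwise Edwards-type approximation at a point with a unique Jensen measure. -/
theorem exists_pshNear_le_of_mem_Oset {X : Set (En n)} (hX : IsCompact X) {z : En n}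
    (hz : z ∈ Oset X) {g : En n → ℝ} (hg : ContinuousOn g X) {ε : ℝ} (hε : 0 < ε) :
    ∃ v, PshNear X v ∧ (∀ x ∈ X, v x ≤ g x) ∧ g z - ε ≤ v z := by
  by_contra! hcon
  have : CompactSpace X := isCompact_iff_compactSpace.1 hX
  let C : Set C(X, ℝ) := {h | ∃ v, PshNear X v ∧ (∀ x : X, v x ≤ h x) ∧ 0 < v z}
  let G : C(X, ℝ) := ⟨X.domRestrict g, hg.domRestrict⟩
  have hconv : Convex ℝ C := by
    rintro h ⟨v, hv, hvh, hvz⟩ k ⟨w, hw, hwk, hwz⟩ a b ha hb hab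
    refine ⟨_, (hv.const_mul ha).add (hw.const_mul hb), fun x => ?_, ?_⟩
    · exact add_le_add (mul_le_mul_of_nonneg_left (hvh x) ha)
        (mul_le_mul_of_nonneg_left (hwk x) hb)
    · rcases ha.eq_or_lt with rfl | ha
      · obtain rfl : b = 1 := by linarith
        simpa using hwz
      · have := mul_pos ha hvz
        have := mul_nonneg hb hwz.le
        linarith
  have hopen : IsOpen C := by
    rw [Metric.isOpen_iff]
    rintro h ⟨v, hv, hvh, hvz⟩
    refine ⟨v z / 2, by linarith, fun k hk => ⟨_, hv.add (.const X (-(v z / 2))), fun x => ?_,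
      by linarith⟩⟩
    have h1 := (ContinuousMap.dist_apply_le_dist (f := k) (g := h) x).trans (mem_ball.1 hk).le
    rw [Real.dist_eq, abs_le] at h1
    have := hvh x
    linarith
  have hnot : G - (g z - ε) • (1 : C(X, ℝ)) ∉ C := by
    rintro ⟨v, hv, hvh, hvz⟩
    have := hcon _ (hv.add (.const X (g z - ε))) fun x hx => by
      have : v x ≤ g x - (g z - ε) * 1 := hvh ⟨x, hx⟩
      linarith
    linarith
  obtain ⟨f, hf⟩ := geometric_hahn_banach_point_open hconv hopen hnot
  have hsmul : ∀ h ∈ C, ∀ t : ℝ, 0 < t → t • h ∈ C := by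
    rintro h ⟨v, hv, hvh, hvz⟩ t ht
    exact ⟨_, hv.const_mul ht.le, fun x => mul_le_mul_of_nonneg_left (hvh x) ht.le,
      mul_pos ht hvz⟩
  have honeC : (1 : C(X, ℝ)) ∈ C := ⟨_, .const X 1, fun x => le_rfl, one_pos⟩
  have hnonneg : ∀ h ∈ C, 0 ≤ f h := fun h hh => by
    by_contra! hneg
    set a := f (G - (g z - ε) • (1 : C(X, ℝ)))
    have := hf _ (hsmul h hh ((|a| + 1) / -f h) (div_pos (by positivity) (by linarith)))
    rw [map_smul, smul_eq_mul, div_mul_eq_mul_div, div_neg, mul_div_assoc, div_self hneg.ne] at this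
    have := neg_abs_le a
    linarith
  have hnonpos : f (G - (g z - ε) • (1 : C(X, ℝ))) ≤ 0 := by
    refine le_of_forall_pos_lt_add fun δ hδ => ?_
    have hpos : 0 < f 1 + 1 := by linarith [hnonneg 1 honeC]
    have := hf _ (hsmul 1 honeC (δ / (f 1 + 1)) (by positivity))
    rw [map_smul, smul_eq_mul] at this
    have h2 : δ / (f 1 + 1) * f 1 ≤ δ := by
      rw [div_mul_eq_mul_div, div_le_iff₀ hpos]
      nlinarith
    linarith
  have hlim : ∀ h : C(X, ℝ), (∀ s : ℝ, 0 < s → h + s • (1 : C(X, ℝ)) ∈ C) → 0 ≤ f h := by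
    intro h hh
    refine le_of_forall_pos_lt_add fun δ hδ => ?_
    have hpos : 0 < f 1 + 1 := by linarith [hnonneg 1 honeC]
    have := hnonneg _ (hh (δ / (f 1 + 1)) (by positivity))
    rw [map_add, map_smul, smul_eq_mul] at this
    have h2 : δ / (f 1 + 1) * f 1 < δ := by
      rw [div_mul_eq_mul_div, div_lt_iff₀ hpos]
      nlinarith
    linarith
  have hposf : ∀ h : C(X, ℝ), 0 ≤ h → 0 ≤ f h := fun h hh => hlim h fun s hs =>
    ⟨_, .const X s, fun x => by
      have h0 : 0 ≤ h x := hh x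
      have : (h + s • (1 : C(X, ℝ))) x = h x + s * 1 := rfl
      linarith, hs⟩
  have hone : 0 < f 1 := by
    refine (hnonneg 1 honeC).lt_of_ne fun h0 => ?_
    have hzero : ∀ h : C(X, ℝ), f h ≤ 0 := fun h => by
      have := hposf (‖h‖ • 1 - h) fun x => by
        have h1 := (le_abs_self _).trans (h.norm_coe_le_norm x)
        change 0 ≤ ‖h‖ * 1 - h x
        linarith
      rw [map_sub, map_smul, ← h0, smul_zero] at this
      linarith
    have h1 := hf 1 honeC
    have h2 := hzero (-(G - (g z - ε) • (1 : C(X, ℝ))))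
    rw [map_neg] at h2
    linarith
  have hdom : ∀ v (hv : PshNear X v),
      f 1 * v z ≤ f ⟨X.domRestrict v, hv.continuousOn.domRestrict⟩ := fun v hv => by
    have := hlim (⟨X.domRestrict v, hv.continuousOn.domRestrict⟩ - v z • 1) fun s hs =>
      ⟨_, hv.add (.const X (-v z + s)), fun x => by
        change v x + (-v z + s) ≤ v x - v z * 1 + s * 1
        linarith, by linarith⟩
    rw [map_sub, map_smul, smul_eq_mul] at this
    linarith
  obtain ⟨μ, hμ, hint⟩ := exists_isJensen_of_functional hX hz.1 f.toLinearMap hposf hone hdom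
  have h1 := hint g hg
  rw [hz.2 μ hμ, integral_dirac] at h1
  rw [map_sub, map_smul, smul_eq_mul] at hnonpos
  change f 1 * g z = f G at h1
  nlinarith

theorem exists_pshNear_le {X : Set (En n)} (hX : IsCompact X) (hreg : IsClosed (Oset X))
    {g : En n → ℝ} (hg : ContinuousOn g X) {ε : ℝ} (hε : 0 < ε) :
    ∃ v, PshNear X v ∧ (∀ x ∈ X, v x ≤ g x) ∧ ∀ x ∈ Oset X, g x - ε ≤ v x := by
  have hsub : Oset X ⊆ X := fun x hx => hx.1
  have hO : IsCompact (Oset X) := hX.of_isClosed_subset hreg hsub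
  refine hO.induction_on
    (p := fun s => ∃ v, PshNear X v ∧ (∀ x ∈ X, v x ≤ g x) ∧ ∀ x ∈ s, g x - ε ≤ v x)
    ?_ ?_ ?_ ?_
  · obtain ⟨c, hc⟩ := hX.bddBelow_image hg
    exact ⟨_, .const X c, fun x hx => hc (mem_image_of_mem g hx), by simp⟩
  · rintro s t hst ⟨v, hv, h1, h2⟩
    exact ⟨v, hv, h1, fun x hx => h2 x (hst hx)⟩
  · rintro s t ⟨v, hv, h1, h2⟩ ⟨w, hw, h3, h4⟩
    refine ⟨_, hv.max hw, fun x hx => max_le (h1 x hx) (h3 x hx), ?_⟩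
    rintro x (hx | hx)
    · exact (h2 x hx).trans (le_max_left _ _)
    · exact (h4 x hx).trans (le_max_right _ _)
  · intro z hz
    obtain ⟨v, hv, h1, h2⟩ := exists_pshNear_le_of_mem_Oset hX hz hg (half_pos hε)
    have hc : ContinuousWithinAt (fun x => g x - v x) (Oset X) z :=
      ((hg.sub hv.continuousOn).mono hsub) z hz
    have hlt : g z - v z < ε := by linarith
    refine ⟨_, hc.eventually_lt_const hlt, v, hv, h1, fun x hx => ?_⟩
    have : g x - v x < ε := hx
    linarith

/-- One step of the approximation: improve the boundary values of `w` while staying close to `w`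
on all of `X`. -/
theorem exists_pshNear_between {X : Set (En n)} (hX : IsCompact X) (hreg : IsClosed (Oset X))
    {Φ : En n → ℝ} (hΦ : ContinuousOn Φ X) {w : En n → ℝ} (hw : PshNear X w) {δ ε : ℝ}
    (hδ : 0 ≤ δ) (hε : 0 < ε) (hwΦ : ∀ x ∈ Oset X, w x ≤ Φ x)
    (hΦw : ∀ x ∈ Oset X, Φ x ≤ w x + δ) :
    ∃ v, PshNear X v ∧ (∀ x ∈ X, w x ≤ v x ∧ v x ≤ w x + δ) ∧
      ∀ x ∈ Oset X, v x ≤ Φ x ∧ Φ x ≤ v x + ε := by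
  obtain ⟨v, hv, h1, h2⟩ := exists_pshNear_le hX hreg
    (hΦ.inf (hw.continuousOn.add (continuousOn_const (c := δ)))) hε
  refine ⟨_, hw.max hv, fun x hx => ⟨le_max_left _ _,
    max_le (by linarith) ((h1 x hx).trans inf_le_right)⟩, fun x hx =>
    ⟨max_le (hwΦ x hx) ((h1 x hx.1).trans inf_le_left), ?_⟩⟩
  have h3 : Φ x ⊓ (w x + δ) - ε ≤ v x := h2 x hx
  have h4 : Φ x ⊓ (w x + δ) = Φ x := inf_of_le_left (hΦw x hx)
  have h5 := le_max_right (w x) (v x)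
  rw [h4] at h3
  linarith

/-- A uniform limit on `X` of functions plurisubharmonic near `X` is continuous and
plurisubharmonic on `X`. -/
theorem PSHcR.of_tendstoUniformlyOn {X : Set (En n)} (hX : IsCompact X) {w : ℕ → En n → ℝ}
    (hw : ∀ j, PshNear X (w j)) {u : En n → ℝ} (h : TendstoUniformlyOn w u atTop X) :
    PSHcR X u := by
  have hu : ContinuousOn u X :=
    h.continuousOn (Eventually.of_forall fun j => (hw j).continuousOn).frequently
  refine ⟨hu, (continuous_coe_real_ereal.comp_continuousOn hu).upperSemicontinuousOn,
    fun z _ => EReal.coe_lt_top _, fun z hz μ hμ => ?_⟩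
  have := hμ.1
  have hi := hu.integrable_of_compl_null hX hμ.2.1
  have hae : ∀ᵐ x ∂μ, x ∈ X := by
    rw [ae_iff]
    exact hμ.2.1
  rw [eint_coe hi, EReal.coe_le_coe_iff]
  refine le_of_forall_pos_le_add fun ε hε => ?_
  obtain ⟨j, hj⟩ := (Metric.tendstoUniformlyOn_iff.1 h (ε / 2) (half_pos hε)).exists
  have h1 := (hw j).le_integral hX hμ
  have h2 : ∫ x, w j x ∂μ ≤ ∫ x, (u x + ε / 2) ∂μ := by
    refine integral_mono_ae ((hw j).continuousOn.integrable_of_compl_null hX hμ.2.1)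
      (hi.add (integrable_const _)) (hae.mono fun x hx => ?_)
    have := abs_lt.1 (Real.dist_eq _ _ ▸ hj x hx)
    simp only
    linarith
  rw [integral_add hi (integrable_const _)] at h2
  have h3 := abs_lt.1 (Real.dist_eq _ _ ▸ hj z hz)
  simp only [integral_const, probReal_univ, one_smul] at h2
  linarith

end

/-- Theorem 4.4: the Dirichlet problem on an `O`-regular compact set. -/
theorem stmt_9 {n : ℕ} (X : Set (En n)) (hX : IsCompact X) (hreg : IsClosed (Oset X))
    (φ : En n → ℝ) (hφ : ContinuousOn φ (Bset X)) :
    ∃ u : En n → ℝ, PSHcR X u ∧ ∀ w ∈ Bset X, u w = φ w := by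
  have hB : Bset X = Oset X := hreg.closure_eq
  rw [hB] at hφ ⊢
  obtain ⟨Φ, hΦ⟩ := ContinuousMap.exists_restrict_eq hreg ⟨(Oset X).domRestrict φ, hφ.domRestrict⟩
  have hΦφ : ∀ x ∈ Oset X, Φ x = φ x := fun x hx => DFunLike.congr_fun hΦ ⟨x, hx⟩
  let P : ℕ → (En n → ℝ) → Prop := fun j w =>
    PshNear X w ∧ ∀ x ∈ Oset X, w x ≤ Φ x ∧ Φ x ≤ w x + 1 / 2 ^ j
  have hstart : ∃ w, P 0 w := by
    obtain ⟨w, hw, h1, h2⟩ := exists_pshNear_le hX hreg Φ.continuous.continuousOn one_pos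
    exact ⟨w, hw, fun x hx => ⟨h1 x hx.1, by linarith [h2 x hx]⟩⟩
  have hstep : ∀ j w, P j w → ∃ v, P (j + 1) v ∧
      ∀ x ∈ X, w x ≤ v x ∧ v x ≤ w x + 1 / 2 ^ j := by
    rintro j w ⟨hw, hwΦ⟩
    obtain ⟨v, hv, h1, h2⟩ := exists_pshNear_between (δ := 1 / 2 ^ j) (ε := 1 / 2 ^ (j + 1))
      hX hreg Φ.continuous.continuousOn hw (by positivity) (by positivity)
      (fun x hx => (hwΦ x hx).1) (fun x hx => (hwΦ x hx).2)
    exact ⟨v, ⟨hv, h2⟩, h1⟩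
  choose! F hF hFclose using hstep
  obtain ⟨w₀, hw₀⟩ := hstart
  let w : ℕ → En n → ℝ := fun j => Nat.rec w₀ (fun j v => F j v) j
  have hw : ∀ j, P j (w j) := fun j => by
    induction j with
    | zero => exact hw₀
    | succ j ih => exact hF j _ ih
  have hdist : ∀ x ∈ X, ∀ j, dist (w j x) (w (j + 1) x) ≤ 2 / 2 / 2 ^ j := fun x hx j => by
    have : w j x ≤ w (j + 1) x ∧ w (j + 1) x ≤ w j x + 1 / 2 ^ j := hFclose j _ (hw j) x hx
    rw [Real.dist_eq, abs_sub_comm, abs_of_nonneg (by linarith), div_self two_ne_zero]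
    linarith
  have hlim : ∀ x, ∃ l, x ∈ X → Tendsto (fun j => w j x) atTop (𝓝 l) := fun x => by
    by_cases hx : x ∈ X
    · obtain ⟨l, hl⟩ := cauchySeq_tendsto_of_complete (cauchySeq_of_le_geometric_two (hdist x hx))
      exact ⟨l, fun _ => hl⟩
    · exact ⟨0, fun h => absurd h hx⟩
  choose u hu using hlim
  have hpow : Tendsto (fun j : ℕ => (2 : ℝ) / 2 ^ j) atTop (𝓝 0) :=
    tendsto_const_nhds.div_atTop (tendsto_pow_atTop_atTop_of_one_lt one_lt_two)
  refine ⟨u, PSHcR.of_tendstoUniformlyOn hX (fun j => (hw j).1) ?_, fun x hx => ?_⟩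
  · rw [Metric.tendstoUniformlyOn_iff]
    intro ε hε
    filter_upwards [hpow.eventually_lt_const hε] with j hj x hx
    rw [dist_comm]
    exact (dist_le_of_le_geometric_two_of_tendsto (hdist x hx) (hu x hx) j).trans_lt hj
  · rw [← hΦφ x hx]
    refine tendsto_nhds_unique (hu x hx.1) ?_
    have hpow' : Tendsto (fun j : ℕ => Φ x - 2 / 2 ^ j) atTop (𝓝 (Φ x)) := by
      simpa using tendsto_const_nhds.sub hpow
    refine tendsto_of_tendsto_of_tendsto_of_le_of_le hpow' tendsto_const_nhds
      (fun j => ?_) (fun j => ((hw j).2 x hx).1)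
    have h1 := ((hw j).2 x hx).2
    have h2 : (1 : ℝ) / 2 ^ j ≤ 2 / 2 ^ j := by gcongr; norm_num
    simp only
    linarith
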